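/- Let d ≥ 1 and let U = {u_1, …, u_k} be a finite set of non-zero vectors in ℤ^d that generate ℤ^d as a group. Let Z_0 = {0,u_1} + ⋯ + {0,u_k}, let Z be the convex hull of Z_0 in ℝ^d, and for t ∈ ℕ let Z(t) = (t·Z) ∩ ℤ^d. Then for every δ > 0 there exists t_0 such that for all t ≥ t_0, the edge boundary of Z(t) satisfies ∂(Z(t)) ≤ (1+δ) d vol(Z)^{1/d} |Z(t)|^{(d−1)/d}. -/

import Mathlib

open Pointwise MeasureTheory

/-- Edge boundary of a finite set `S ⊆ ℤ^d` in the Cayley graph generated by `u`. -/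
def edgeBdry {d k : ℕ} (u : Fin k → (Fin d → ℤ)) (S : Finset (Fin d → ℤ)) : ℕ :=
  ∑ i, (S.filter (fun v => v + u i ∉ S)).card

/-- Embedding of `ℤ^d` into `ℝ^d`. -/
def toReal' {d : ℕ} (v : Fin d → ℤ) : Fin d → ℝ := fun j => (v j : ℝ)

open Filter Topology

/-- If `S ⊆ T` and `S` meets every line in direction `w` in an interval, then `S` has no more
exit points in direction `w` than `T` does. -/
lemma card_filter_add_notMem_le {G : Type*} [AddCommGroup G] [IsAddTorsionFree G] [DecidableEq G]
    {w : G} (hw : w ≠ 0) {S T : Finset G} (hST : S ⊆ T)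
    (hS : ∀ v ∈ S, ∀ n : ℕ, v + (n + 1) • w ∈ S → v + w ∈ S) :
    (S.filter (fun v => v + w ∉ S)).card ≤ (T.filter (fun v => v + w ∉ T)).card := by
  have hex : ∀ v ∈ T, ∃ n : ℕ, v + n • w ∈ T ∧ v + n • w + w ∉ T := by
    intro v hv
    by_contra! h
    have hall : ∀ n : ℕ, v + n • w ∈ T := by
      intro n
      induction n with
      | zero => simpa using hv
      | succ n ih => simpa [succ_nsmul, add_assoc] using h n ih
    refine Set.infinite_of_injective_forall_mem (f := fun n : ℕ => v + n • w) ?_ hall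
      T.finite_toSet
    exact (add_right_injective v).comp (injective_nsmul_iff_not_isOfFinAddOrder.2
      (not_isOfFinAddOrder_of_isAddTorsionFree hw))
  choose! f hf using hex
  have aux : ∀ v ∈ S, v + w ∉ S → ∀ v' ∈ S, v + f v • w = v' + f v' • w → f v ≤ f v' := by
    intro v hv hvw v' hv' h
    by_contra! hlt
    obtain ⟨n, hn⟩ := Nat.exists_eq_add_of_lt hlt
    refine hvw (hS v hv n ?_)
    have : v + (n + 1) • w = v' := by
      rw [hn, add_assoc, add_comm (f v'), add_nsmul, ← add_assoc] at h
      exact add_right_cancel h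
    rwa [this]
  refine Finset.card_le_card_of_injOn (fun v => v + f v • w) ?_ ?_
  · intro v hv
    have hv : v ∈ S ∧ v + w ∉ S := by simpa using hv
    simpa using hf v (hST hv.1)
  · intro v hv v' hv' h
    have hv : v ∈ S ∧ v + w ∉ S := by simpa using hv
    have hv' : v' ∈ S ∧ v' + w ∉ S := by simpa using hv'
    have h : v + f v • w = v' + f v' • w := h
    have he : f v = f v' :=
      le_antisymm (aux v hv.1 hv.2 v' hv'.1 h) (aux v' hv'.1 hv'.2 v hv.1 h.symm)
    rw [he] at h
    exact add_right_cancel h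

lemma card_add_pair {G : Type*} [AddCommGroup G] [DecidableEq G] (w : G) (T : Finset G) :
    (T + {0, w}).card = T.card + (T.filter (fun v => v + w ∉ T)).card := by
  have h : T + {0, w} = T ∪ (T.filter (fun v => v + w ∉ T)).image (· + w) := by
    ext x
    simp only [Finset.mem_add, Finset.mem_insert, Finset.mem_singleton, Finset.mem_union,
      Finset.mem_image, Finset.mem_filter]
    constructor
    · rintro ⟨y, hy, z, rfl | rfl, rfl⟩
      · simp [hy]
      · by_cases hyz : y + z ∈ T
        · exact Or.inl hyz
        · exact Or.inr ⟨y, ⟨hy, hyz⟩, rfl⟩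
    · rintro (hx | ⟨y, ⟨hy, -⟩, rfl⟩)
      · exact ⟨x, hx, 0, by simp⟩
      · exact ⟨y, hy, w, by simp⟩
  rw [h, Finset.card_union_of_disjoint, Finset.card_image_of_injective _ (add_left_injective w)]
  rw [Finset.disjoint_right]
  intro x hx
  obtain ⟨y, hy, rfl⟩ := Finset.mem_image.1 hx
  exact (Finset.mem_filter.1 hy).2

/-- Adding `∑ i, {0, u i}` to any superset of a line-convex set `S` increases the cardinality by
at least the edge boundary of `S`. -/
lemma card_add_sum_pair_ge {G ι : Type*} [AddCommGroup G] [IsAddTorsionFree G] [DecidableEq G]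
    {u : ι → G} (hu : ∀ i, u i ≠ 0) {S T : Finset G} (hST : S ⊆ T)
    (hS : ∀ i, ∀ v ∈ S, ∀ n : ℕ, v + (n + 1) • u i ∈ S → v + u i ∈ S) (s : Finset ι) :
    S ⊆ T + ∑ i ∈ s, {0, u i} ∧
    T.card + ∑ i ∈ s, (S.filter (fun v => v + u i ∉ S)).card
      ≤ (T + ∑ i ∈ s, ({0, u i} : Finset G)).card := by
  classical
  induction s using Finset.induction_on with
  | empty => simpa using hST
  | insert i s hi ih =>
    rw [Finset.sum_insert hi, Finset.sum_insert hi, add_comm ({0, u i} : Finset G), ← add_assoc]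
    refine ⟨ih.1.trans (Finset.subset_add_left _ (by simp)), ?_⟩
    rw [card_add_pair]
    have := card_filter_add_notMem_le (hu i) ih.1 (hS i)
    omega

lemma eventually_le_rpow_of_tendsto_div_pow {d : ℕ} (hd : 1 ≤ d) {c b : ℕ → ℝ} {V : ℝ}
    (hV : 0 < V) (hc0 : ∀ t, 0 ≤ c t)
    (hc : Tendsto (fun t : ℕ => c t / (t : ℝ) ^ d) atTop (𝓝 V))
    (hb : ∀ t n : ℕ, n * b t ≤ c (t + n) - c t) {δ : ℝ} (hδ : 0 < δ) :
    ∀ᶠ t : ℕ in atTop,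
      b t ≤ (1 + δ) * d * V ^ ((1 : ℝ) / d) * c t ^ (((d : ℝ) - 1) / d) := by
  have hd0 : (0 : ℝ) < d := by exact_mod_cast hd
  obtain ⟨ε, hε, hεd⟩ : ∃ ε : ℝ, 0 < ε ∧ ((1 + ε) ^ d - 1) / ε < (1 + δ) * d := by
    have hder : HasDerivAt (fun x : ℝ => x ^ d) (d : ℝ) 1 := by simpa using hasDerivAt_pow d (1 : ℝ)
    have hlim := hder.tendsto_slope_zero_right
    have hlt : (d : ℝ) < (1 + δ) * d := by nlinarith
    obtain ⟨ε, h1, h2⟩ := ((hlim.eventually_lt_const hlt).and self_mem_nhdsWithin).exists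
    exact ⟨ε, h2, by simpa [div_eq_inv_mul] using h1⟩
  have hm : Tendsto (fun t : ℕ => (⌊ε * t⌋₊ : ℝ) / t) atTop (𝓝 ε) :=
    (tendsto_nat_floor_mul_div_atTop hε.le).comp tendsto_natCast_atTop_atTop
  have hshift : Tendsto (fun t : ℕ => t + ⌊ε * t⌋₊) atTop atTop :=
    tendsto_atTop_mono (fun t => Nat.le_add_right t _) tendsto_id
  have hF : Tendsto (fun t : ℕ => (c (t + ⌊ε * t⌋₊) / ((t + ⌊ε * t⌋₊ : ℕ) : ℝ) ^ d *
      (1 + (⌊ε * t⌋₊ : ℝ) / t) ^ d - c t / (t : ℝ) ^ d) / ((⌊ε * t⌋₊ : ℝ) / t)) atTop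
      (𝓝 ((V * (1 + ε) ^ d - V) / ε)) :=
    (((hc.comp hshift).mul ((tendsto_const_nhds.add hm).pow d)).sub hc).div hm hε.ne'
  have hG : Tendsto (fun t : ℕ => (1 + δ) * d * V ^ ((1 : ℝ) / d) *
      (c t / (t : ℝ) ^ d) ^ (((d : ℝ) - 1) / d)) atTop
      (𝓝 ((1 + δ) * d * V ^ ((1 : ℝ) / d) * V ^ (((d : ℝ) - 1) / d))) :=
    (hc.rpow_const (Or.inl hV.ne')).const_mul _
  have hlt : (V * (1 + ε) ^ d - V) / ε
      < (1 + δ) * d * V ^ ((1 : ℝ) / d) * V ^ (((d : ℝ) - 1) / d) := by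
    rw [mul_assoc _ (V ^ _), ← Real.rpow_add hV, ← add_div, add_sub_cancel, div_self hd0.ne',
      Real.rpow_one]
    calc (V * (1 + ε) ^ d - V) / ε = ((1 + ε) ^ d - 1) / ε * V := by ring
      _ < _ := by gcongr
  filter_upwards [hF.eventually_lt hG hlt, eventually_gt_atTop 0, hm.eventually_const_lt hε]
    with t ht ht0 hm0
  have ht0' : (0 : ℝ) < t := by exact_mod_cast ht0
  have hmpos : (0 : ℝ) < ⌊ε * t⌋₊ := (div_pos_iff_of_pos_right ht0').1 hm0
  have hpow : ((t : ℝ) ^ d) ^ (((d : ℝ) - 1) / d) = (t : ℝ) ^ (d - 1) := by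
    rw [← Real.rpow_natCast, ← Real.rpow_mul ht0'.le, mul_div_cancel₀ _ hd0.ne',
      ← Real.rpow_natCast, Nat.cast_sub hd, Nat.cast_one]
  rw [Real.div_rpow (hc0 t) (by positivity), hpow] at ht
  have key := hb t ⌊ε * t⌋₊
  have hsucc : (t : ℝ) ^ d = t ^ (d - 1) * t := by rw [← pow_succ, Nat.sub_add_cancel hd]
  have hFeq : (c (t + ⌊ε * t⌋₊) / ((t + ⌊ε * t⌋₊ : ℕ) : ℝ) ^ d *
      (1 + (⌊ε * t⌋₊ : ℝ) / t) ^ d - c t / (t : ℝ) ^ d) / ((⌊ε * t⌋₊ : ℝ) / t)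
      = (c (t + ⌊ε * t⌋₊) - c t) / ⌊ε * t⌋₊ / t ^ (d - 1) := by
    have h1 : (1 + (⌊ε * t⌋₊ : ℝ) / t) = ((t + ⌊ε * t⌋₊ : ℕ) : ℝ) / t := by
      push_cast; field_simp
    have h2 : (((t + ⌊ε * t⌋₊ : ℕ) : ℝ)) ^ d ≠ 0 := by positivity
    rw [h1, div_pow, div_mul_div_cancel₀ h2, hsucc]
    field_simp
  rw [hFeq, ← mul_div_assoc] at ht
  rw [div_lt_div_iff_of_pos_right (by positivity)] at ht
  exact (((le_div_iff₀' hmpos).2 key).trans_lt ht).le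

lemma toReal'_injective {d : ℕ} : Function.Injective (toReal' (d := d)) := fun v w h => by
  ext j
  exact Int.cast_injective (α := ℝ) (congrFun h j)

lemma toReal'_add {d : ℕ} (v w : Fin d → ℤ) : toReal' (v + w) = toReal' v + toReal' w := by
  ext j; simp [toReal']

lemma toReal'_nsmul {d : ℕ} (n : ℕ) (v : Fin d → ℤ) : toReal' (n • v) = (n : ℝ) • toReal' v := by
  ext j; simp [toReal']

lemma finite_preimage_toReal' {d : ℕ} {s : Set (Fin d → ℝ)} (hs : Bornology.IsBounded s) :
    (toReal' ⁻¹' s).Finite := by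
  have hfin : (s ∩ Submodule.span ℤ (Set.range (Pi.basisFun ℝ (Fin d)))).Finite :=
    ZSpan.setFinite_inter _ hs
  refine (hfin.preimage toReal'_injective.injOn).subset fun v hv => ⟨hv, ?_⟩
  exact (Module.Basis.mem_span_iff_repr_mem ℤ _ _).2 fun j => ⟨v j, by simp [toReal']⟩

/-- Lattice points of dilates count volume, in terms of integer vectors. -/
lemma tendsto_ncard_preimage_toReal' {d : ℕ} {s : Set (Fin d → ℝ)}
    (hs : Bornology.IsBounded s) (hm : MeasurableSet s) (hf : volume (frontier s) = 0) :
    Tendsto (fun t : ℕ => ((toReal' ⁻¹' ((t : ℝ) • s)).ncard : ℝ) / (t : ℝ) ^ d) atTop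
      (𝓝 (volume s).toReal) := by
  have h := tendsto_card_div_pow_atTop_volume s hs hm hf
  rw [Fintype.card_fin] at h
  refine h.congr' ?_
  filter_upwards [eventually_gt_atTop 0] with t ht
  have ht' : (t : ℝ) ≠ 0 := by positivity
  congr 2
  rw [Nat.card_coe_set_eq]
  have hinj : Function.Injective fun v : Fin d → ℤ => (t : ℝ)⁻¹ • toReal' v :=
    (smul_right_injective _ (inv_ne_zero ht')).comp toReal'_injective
  rw [← Set.ncard_image_of_injective _ hinj]
  congr 1
  ext x
  constructor
  · rintro ⟨hx, y, hy, rfl⟩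
    have hy' := (Module.Basis.mem_span_iff_repr_mem ℤ (Pi.basisFun ℝ (Fin d)) y).1 hy
    choose v hv using hy'
    have hvy : toReal' v = y := by
      ext j; simpa [toReal'] using hv j
    refine ⟨v, ?_, by simp [hvy]⟩
    rw [Set.mem_preimage, hvy, Set.mem_smul_set_iff_inv_smul_mem₀ ht']
    exact hx
  · rintro ⟨v, hv, rfl⟩
    refine ⟨(Set.mem_smul_set_iff_inv_smul_mem₀ ht' _ _).1 hv, toReal' v, ?_, rfl⟩
    exact (Module.Basis.mem_span_iff_repr_mem ℤ _ _).2 fun j => ⟨v j, by simp [toReal']⟩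

lemma span_toReal'_eq_top {d k : ℕ} {u : Fin k → (Fin d → ℤ)}
    (hgen : AddSubgroup.closure (Set.range u) = ⊤) :
    Submodule.span ℝ (Set.range fun i => toReal' (u i)) = ⊤ := by
  have hall : ∀ v, toReal' v ∈ Submodule.span ℝ (Set.range fun i => toReal' (u i)) := by
    intro v
    have hv : v ∈ AddSubgroup.closure (Set.range u) := hgen ▸ AddSubgroup.mem_top v
    induction hv using AddSubgroup.closure_induction with
    | mem x hx =>
      obtain ⟨i, rfl⟩ := hx
      exact Submodule.subset_span ⟨i, rfl⟩
    | zero =>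
      convert Submodule.zero_mem _
      ext j; simp [toReal']
    | add x y _ _ hx hy => rw [toReal'_add]; exact add_mem hx hy
    | neg x _ hx =>
      convert neg_mem hx
      ext j; simp [toReal']
  rw [eq_top_iff, ← (Pi.basisFun ℝ (Fin d)).span_eq, Submodule.span_le]
  rintro _ ⟨j, rfl⟩
  have hj : toReal' (Pi.single j 1) = Pi.basisFun ℝ (Fin d) j := by
    ext l
    by_cases h : l = j
    · subst h; simp [toReal']
    · simp [toReal', h]
  exact hj ▸ hall (Pi.single j 1)

lemma zero_mem_sum_pair {G ι : Type*} [AddCommGroup G] [DecidableEq G] (u : ι → G)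
    (s : Finset ι) : (0 : G) ∈ ∑ i ∈ s, ({0, u i} : Finset G) := by
  classical
  induction s using Finset.induction_on with
  | empty => simp
  | insert i s hi ih =>
    rw [Finset.sum_insert hi]
    exact Finset.mem_add.2 ⟨0, by simp, 0, ih, by simp⟩

lemma mem_sum_pair {G ι : Type*} [AddCommGroup G] [DecidableEq G] (u : ι → G)
    {s : Finset ι} {i : ι} (hi : i ∈ s) : u i ∈ ∑ i ∈ s, ({0, u i} : Finset G) := by
  classical
  rw [← Finset.add_sum_erase _ _ hi]
  exact Finset.mem_add.2 ⟨u i, by simp, 0, zero_mem_sum_pair u _, by simp⟩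

/-- The lattice points of a convex set meet every line in an interval. -/
lemma toReal'_add_mem_of_convex {d : ℕ} {s : Set (Fin d → ℝ)} (hs : Convex ℝ s)
    {v w : Fin d → ℤ} {n : ℕ} (hv : toReal' v ∈ s) (hvn : toReal' (v + (n + 1) • w) ∈ s) :
    toReal' (v + w) ∈ s := by
  have h := hs.add_smul_mem hv (y := ((n + 1 : ℕ) : ℝ) • toReal' w)
    (by rwa [← toReal'_nsmul, ← toReal'_add]) (t := ((n + 1 : ℕ) : ℝ)⁻¹)
    ⟨by positivity, inv_le_one_of_one_le₀ (by simp)⟩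
  rwa [smul_smul, inv_mul_cancel₀ (by positivity), one_smul, ← toReal'_add] at h

theorem edge_boundary_of_scaled_zonotope (d k : ℕ) (hd : 1 ≤ d)
    (u : Fin k → (Fin d → ℤ)) (hu : ∀ i, u i ≠ 0)
    (hgen : AddSubgroup.closure (Set.range u) = ⊤)
    (Z0 : Finset (Fin d → ℤ))
    (hZ0 : Z0 = ∑ i, ({0, u i} : Finset (Fin d → ℤ)))
    (Z : Set (Fin d → ℝ))
    (hZ : Z = convexHull ℝ (toReal' '' (Z0 : Set (Fin d → ℤ))))
    (δ : ℝ) (hδ : 0 < δ) :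
    ∃ t₀ : ℕ, ∀ t : ℕ, t₀ ≤ t → ∀ Zt : Finset (Fin d → ℤ),
      (∀ v : Fin d → ℤ, v ∈ Zt ↔ toReal' v ∈ (t : ℝ) • Z) →
      (edgeBdry u Zt : ℝ)
        ≤ (1 + δ) * d * (volume Z).toReal ^ ((1 : ℝ) / d)
            * (Zt.card : ℝ) ^ (((d : ℝ) - 1) / d) := by
  have hconv : Convex ℝ Z := hZ ▸ convex_convexHull ℝ _
  have hfinite : (toReal' '' (Z0 : Set (Fin d → ℤ))).Finite := Z0.finite_toSet.image _
  have hcomp : IsCompact Z := hZ ▸ hfinite.isCompact_convexHull ℝ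
  have hZ0Z : ∀ v ∈ Z0, toReal' v ∈ Z := fun v hv =>
    hZ ▸ subset_convexHull ℝ _ ⟨v, hv, rfl⟩
  have h0Z0 : (0 : Fin d → ℤ) ∈ Z0 := hZ0 ▸ zero_mem_sum_pair u _
  have hreal0 : toReal' (0 : Fin d → ℤ) = 0 := by ext j; simp [toReal']
  have hpos : 0 < (volume Z).toReal := by
    refine ENNReal.toReal_pos ?_ hcomp.measure_lt_top.ne
    refine ((isOpen_interior.measure_pos volume ?_).trans_le (measure_mono interior_subset)).ne'
    have hmem0 : (0 : Fin d → ℝ) ∈ toReal' '' (Z0 : Set (Fin d → ℤ)) := ⟨0, h0Z0, hreal0⟩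
    rw [hZ, interior_convexHull_nonempty_iff_affineSpan_eq_top,
      AffineSubspace.affineSpan_eq_top_iff_vectorSpan_eq_top_of_nonempty _ _ _ ⟨0, hmem0⟩,
      eq_top_iff, ← span_toReal'_eq_top hgen, Submodule.span_le]
    rintro _ ⟨i, rfl⟩
    have hi : u i ∈ Z0 := hZ0 ▸ mem_sum_pair u (Finset.mem_univ i)
    simpa using vsub_mem_vectorSpan ℝ (Set.mem_image_of_mem toReal' hi) hmem0
  have hfin : ∀ t : ℕ, (toReal' ⁻¹' ((t : ℝ) • Z)).Finite := fun t =>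
    finite_preimage_toReal' (hcomp.isBounded.smul₀ _)
  set P : ℕ → Finset (Fin d → ℤ) := fun t => (hfin t).toFinset with hP
  have hmemP : ∀ t v, v ∈ P t ↔ toReal' v ∈ (t : ℝ) • Z := fun t v => by simp [hP]
  have hadd : ∀ t n, P t + P n ⊆ P (t + n) := by
    intro t n x hx
    obtain ⟨v, hv, w, hw, rfl⟩ := Finset.mem_add.1 hx
    rw [hmemP, toReal'_add, Nat.cast_add, hconv.add_smul (by positivity) (by positivity)]
    exact Set.add_mem_add ((hmemP _ _).1 hv) ((hmemP _ _).1 hw)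
  have h0P : ∀ t, (0 : Fin d → ℤ) ∈ P t := fun t =>
    (hmemP _ _).2 (by
      rw [hreal0]; exact Set.zero_mem_smul_set (hreal0 ▸ hZ0Z 0 h0Z0))
  have hZ0P : Z0 ⊆ P 1 := fun v hv => (hmemP _ _).2 (by simpa using hZ0Z v hv)
  have hstep : ∀ t n, (P (t + n)).card + edgeBdry u (P t) ≤ (P (t + n + 1)).card := by
    intro t n
    have hsub : P t ⊆ P (t + n) := (Finset.subset_add_left _ (h0P n)).trans (hadd t n)
    have hline : ∀ i, ∀ v ∈ P t, ∀ n : ℕ, v + (n + 1) • u i ∈ P t → v + u i ∈ P t := by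
      intro i v hv n hvn
      rw [hmemP] at hv hvn ⊢
      exact toReal'_add_mem_of_convex (hconv.smul _) hv hvn
    refine (card_add_sum_pair_ge hu hsub hline Finset.univ).2.trans (Finset.card_le_card ?_)
    rw [← hZ0]
    exact (Finset.add_subset_add_left hZ0P).trans (hadd _ 1)
  have hgrow : ∀ t n : ℕ,
      (n : ℝ) * edgeBdry u (P t) ≤ ((P (t + n)).card : ℝ) - (P t).card := by
    intro t n
    induction n with
    | zero => simp
    | succ n ih =>
      have h : ((P (t + n)).card : ℝ) + edgeBdry u (P t) ≤ (P (t + n + 1)).card := by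
        exact_mod_cast hstep t n
      rw [← add_assoc]
      push_cast
      linarith
  have hlim : Tendsto (fun t : ℕ => ((P t).card : ℝ) / (t : ℝ) ^ d) atTop
      (𝓝 (volume Z).toReal) := by
    simpa only [hP, ← Set.ncard_eq_toFinset_card] using
      tendsto_ncard_preimage_toReal' hcomp.isBounded hcomp.measurableSet
        (hconv.addHaar_frontier volume)
  obtain ⟨t₀, ht₀⟩ := eventually_atTop.1
    (eventually_le_rpow_of_tendsto_div_pow hd hpos (fun _ => Nat.cast_nonneg _) hlim hgrow hδ)
  refine ⟨t₀, fun t ht Zt hZt => ?_⟩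
  obtain rfl : Zt = P t := by
    ext v; rw [hZt, hmemP]
  exact ht₀ t ht
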